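/- Let G be a finite group, x, y ∈ G, and χ₁, χ₂ ∈ Irr(G) such that χ₁(x) - χ₁(y) = χ₂(y) - χ₂(x) ≠ 0, and every other irreducible character of G takes equal values on x and y. If ψ is a character of G with ψ(x) = ψ(y), and m₁ = ⟨ψχ₁, χ₁⟩, m₂ = ⟨ψχ₁, χ₂⟩ are the multiplicities of χ₁ and χ₂ in ψ·χ₁, then ψ(x) = m₁ - m₂. -/

import Mathlib

open CategoryTheory

noncomputable section

/-- `ψ` is a (complex) character of the finite group `G`:
the character of some finite-dimensional complex representation. -/
def IsChar (G : Type) [Group G] (ψ : G → ℂ) : Prop :=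
  ∃ V : FDRep ℂ G, ∀ g, ψ g = V.character g

/-- `χ` is an irreducible (complex) character of `G`. -/
def IsIrrChar (G : Type) [Group G] (χ : G → ℂ) : Prop :=
  ∃ V : FDRep ℂ G, Simple V ∧ ∀ g, χ g = V.character g

/-- The standard inner product of class functions on a finite group. -/
def charInner (G : Type) [Group G] [Fintype G] (φ θ : G → ℂ) : ℂ :=
  (Fintype.card G : ℂ)⁻¹ * ∑ g : G, φ g * (starRingEnd ℂ) (θ g)


section Helpers

open Module

/-- The character of a representation is the sum of the characters of two complementary
subrepresentations. -/
lemma character_eq_add_of_isCompl {k G V : Type*} [Field k] [Monoid G] [AddCommGroup V]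
    [Module k V] [FiniteDimensional k V] (ρ : Representation k G V) {p q : Subrepresentation ρ}
    (h : IsCompl p q) :
    ρ.character = p.toRepresentation.character + q.toRepresentation.character := by
  have hc : IsCompl p.toSubmodule q.toSubmodule := by
    refine ⟨disjoint_iff.2 ?_, codisjoint_iff.2 ?_⟩
    · exact congrArg Subrepresentation.toSubmodule h.inf_eq_bot
    · exact congrArg Subrepresentation.toSubmodule h.sup_eq_top
  funext g
  have hi : DirectSum.IsInternal (fun b : Bool => cond b p.toSubmodule q.toSubmodule) :=
    (DirectSum.isInternal_submodule_iff_isCompl _ (i := true) (j := false) (by decide)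
      (by ext b; cases b <;> simp)).2 hc
  have := LinearMap.trace_eq_sum_trace_restrict hi (f := ρ g) (by
    rintro (_ | _)
    · exact q.apply_mem_toSubmodule g
    · exact p.apply_mem_toSubmodule g)
  rw [Fintype.sum_bool] at this
  exact this

/-- A property of functions that is additive and holds for irreducible characters holds for all
characters of a finite group in non-modular characteristic. -/
lemma character_induction {k : Type*} {G : Type*} [Field k] [Group G] [Finite G]
    [NeZero (Nat.card G : k)] {P : (G → k) → Prop} (zero : P 0)
    (add : ∀ φ θ, P φ → P θ → P (φ + θ))
    (irr : ∀ (W : Type) [AddCommGroup W] [Module k W] [FiniteDimensional k W]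
      (σ : Representation k G W), σ.IsIrreducible → P σ.character)
    {V : Type} [AddCommGroup V] [Module k V] [FiniteDimensional k V]
    (ρ : Representation k G V) : P ρ.character := by
  induction hn : finrank k V using Nat.strong_induction_on generalizing V with
  | _ n ih =>
    subst hn
    rcases subsingleton_or_nontrivial V with hV | hV
    · have h0 : ρ.character = 0 := by
        funext g
        have : ρ g = 0 := Subsingleton.elim _ _
        simp [Representation.character, this]
      rwa [h0]
    by_cases hirr : ∀ p : Subrepresentation ρ, p = ⊥ ∨ p = ⊤
    · have : Nontrivial (Subrepresentation ρ) :=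
        ⟨⊥, ⊤, fun h => bot_ne_top (α := Submodule k V)
          (congrArg Subrepresentation.toSubmodule h)⟩
      exact irr V ρ ⟨hirr⟩
    push Not at hirr
    obtain ⟨p, hp, hp'⟩ := hirr
    obtain ⟨q, hpq⟩ := exists_isCompl p
    have hlt : ∀ r : Subrepresentation ρ, r ≠ ⊤ → finrank k r.toSubmodule < finrank k V :=
      fun r hr => Submodule.finrank_lt fun h => hr (Subrepresentation.toSubmodule_injective h)
    rw [character_eq_add_of_isCompl ρ hpq]
    refine add _ _ (ih _ (hlt p hp') _ rfl) (ih _ (hlt q fun h => hp ?_) _ rfl)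
    rw [h] at hpq
    exact eq_bot_of_isCompl_top hpq

/-- A one-dimensional representation acts by scalar multiplication by its character. -/
lemma eq_character_smul_id_of_finrank_eq_one {k G V : Type*} [Field k] [Monoid G]
    [AddCommGroup V] [Module k V] (ρ : Representation k G V)
    (h : finrank k V = 1) (g : G) : ρ g = ρ.character g • LinearMap.id := by
  obtain ⟨c, hc⟩ := (LinearEquiv.smul_id_of_finrank_eq_one h).surjective (ρ g)
  have hc' : ρ g = c • LinearMap.id := by rw [← hc]; rfl
  have := Module.finite_of_finrank_eq_succ h
  rw [Representation.character, hc', map_smul, LinearMap.trace_id, h, Nat.cast_one, smul_eq_mul,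
    mul_one]

/-- The character of a one-dimensional representation is multiplicative. -/
lemma character_mul_of_finrank_eq_one {k G V : Type*} [Field k] [Monoid G]
    [AddCommGroup V] [Module k V] (ρ : Representation k G V)
    (h : finrank k V = 1) (a b : G) :
    ρ.character (a * b) = ρ.character a * ρ.character b := by
  conv_lhs => rw [Representation.character, map_mul, eq_character_smul_id_of_finrank_eq_one ρ h a]
  change LinearMap.trace k V ((ρ.character a • LinearMap.id) ∘ₗ ρ b) = _
  simp [Representation.character, LinearMap.smul_comp]

/-- Characters of finite groups satisfy `χ(g⁻¹) = conj χ(g)`. -/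
lemma character_inv_eq_conj {G : Type*} {V : Type} [Group G] [Finite G] [AddCommGroup V]
    [Module ℂ V] [FiniteDimensional ℂ V] (ρ : Representation ℂ G V) (g : G) :
    ρ.character g⁻¹ = starRingEnd ℂ (ρ.character g) := by
  let H := Subgroup.zpowers g
  have key : ∀ a : H, Representation.character (ρ.comp H.subtype) a⁻¹ =
      starRingEnd ℂ (Representation.character (ρ.comp H.subtype) a) := by
    refine character_induction (P := fun φ : H → ℂ => ∀ a, φ a⁻¹ = starRingEnd ℂ (φ a))
      (by simp) (fun φ θ hφ hθ a => by simp [hφ, hθ]) (fun W _ _ _ σ hσ a => ?_) _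
    have h1 : finrank ℂ W = 1 := hσ.finrank_eq_one_of_isMulCommutative σ
    let χ : H →* ℂ :=
      { toFun := σ.character
        map_one' := by simp [Representation.character, h1]
        map_mul' := character_mul_of_finrank_eq_one σ h1 }
    have hpow : χ a ^ Nat.card H = 1 := by rw [← map_pow, pow_card_eq_one', map_one]
    have hnorm := Complex.norm_eq_one_of_pow_eq_one hpow Nat.card_pos.ne'
    change χ a⁻¹ = starRingEnd ℂ (χ a)
    rw [← Complex.inv_eq_conj hnorm]
    exact eq_inv_of_mul_eq_one_left (by rw [← map_mul, inv_mul_cancel, map_one])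
  exact key ⟨g, Subgroup.mem_zpowers g⟩

/-- The `FDRep` of an irreducible representation of a finite group is simple. -/
lemma isIrrChar_character {G V : Type} [Group G] [Finite G] [AddCommGroup V] [Module ℂ V]
    [FiniteDimensional ℂ V] (ρ : Representation ℂ G V) (hρ : ρ.IsIrreducible) :
    IsIrrChar G ρ.character := by
  refine ⟨FDRep.of ρ, ?_, fun g => rfl⟩
  have := Fintype.ofFinite G
  have hcard : (Nat.card G : ℂ) ≠ 0 := NeZero.ne _
  have := invertibleOfNonzero hcard
  rw [FDRep.simple_iff_char_is_norm_one]
  have h := Representation.char_orthonormal ρ ρ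
  rw [if_pos ⟨Representation.Equiv.refl ρ⟩, inv_mul_eq_one₀ hcard] at h
  exact h.symm

/-- Irreducible characters are orthonormal. -/
lemma charInner_of_isIrrChar {G : Type} [Group G] [Fintype G] {χ θ : G → ℂ}
    (hχ : IsIrrChar G χ) (hθ : IsIrrChar G θ) [Decidable (χ = θ)] :
    charInner G χ θ = if χ = θ then 1 else 0 := by
  have := invertibleOfNonzero (NeZero.ne (Nat.card G : ℂ))
  have key : ∀ (V W : FDRep ℂ G), charInner G V.character W.character =
      (Nat.card G : ℂ)⁻¹ * ∑ g : G, V.character g * W.character g⁻¹ := by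
    intro V W
    rw [charInner, Nat.card_eq_fintype_card]
    congr! 3 with g
    exact (character_inv_eq_conj W.ρ g).symm
  obtain ⟨V, _, hV⟩ := hχ
  obtain ⟨W, _, hW⟩ := hθ
  obtain rfl : χ = V.character := funext hV
  obtain rfl : θ = W.character := funext hW
  split_ifs with h
  · rw [← h, key, FDRep.char_orthonormal, if_pos ⟨Iso.refl V⟩]
  · rw [key, FDRep.char_orthonormal, if_neg fun ⟨i⟩ => h (FDRep.char_iso i)]

lemma charInner_add {G : Type} [Group G] [Fintype G] (φ φ' θ : G → ℂ) :
    charInner G (φ + φ') θ = charInner G φ θ + charInner G φ' θ := by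
  simp [charInner, add_mul, Finset.sum_add_distrib, mul_add]

/-- If only the distinct irreducible characters `χ₁`, `χ₂` can differ on `x` and `y`, then the
difference of any character at `x` and `y` is determined by its multiplicities at `χ₁`, `χ₂`. -/
lemma character_sub_eq {G : Type} [Group G] [Fintype G] {x y : G} {χ₁ χ₂ : G → ℂ}
    (h1 : IsIrrChar G χ₁) (h2 : IsIrrChar G χ₂) (h12 : χ₁ ≠ χ₂)
    (hothers : ∀ χ : G → ℂ, IsIrrChar G χ → χ ≠ χ₁ → χ ≠ χ₂ → χ x = χ y)
    {φ : G → ℂ} (hφ : IsChar G φ) :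
    φ x - φ y = charInner G φ χ₁ * (χ₁ x - χ₁ y) + charInner G φ χ₂ * (χ₂ x - χ₂ y) := by
  classical
  obtain ⟨V, hV⟩ := hφ
  obtain rfl : φ = Representation.character V.ρ := funext hV
  refine character_induction (P := fun φ : G → ℂ => φ x - φ y =
    charInner G φ χ₁ * (χ₁ x - χ₁ y) + charInner G φ χ₂ * (χ₂ x - χ₂ y))
    (by simp [charInner]) (fun φ θ hφ hθ => ?_) (fun W _ _ _ σ hσ => ?_) V.ρ
  · simp only [charInner_add, Pi.add_apply]
    linear_combination hφ + hθ
  · have hσ' := isIrrChar_character σ hσ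
    rw [charInner_of_isIrrChar hσ' h1, charInner_of_isIrrChar hσ' h2]
    by_cases e1 : σ.character = χ₁
    · simp [e1, h12]
    by_cases e2 : σ.character = χ₂
    · simp [e2, h12.symm]
    simp [e1, e2, hothers _ hσ' e1 e2]

lemma IsChar.mul {G : Type} [Group G] {φ θ : G → ℂ} (hφ : IsChar G φ) (hθ : IsChar G θ) :
    IsChar G (fun g => φ g * θ g) := by
  obtain ⟨V, hV⟩ := hφ
  obtain ⟨W, hW⟩ := hθ
  exact ⟨MonoidalCategoryStruct.tensorObj V W, fun g => by simp [hV, hW]⟩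

lemma IsIrrChar.isChar {G : Type} [Group G] {χ : G → ℂ} (hχ : IsIrrChar G χ) : IsChar G χ :=
  let ⟨V, _, hV⟩ := hχ
  ⟨V, hV⟩

end Helpers

/-- If `x^G, y^G` is a detecting pair for the irreducible characters `χ₁, χ₂`
and `ψ` is a character with `ψ(x) = ψ(y)`, then `ψ(x) = m₁ - m₂` where `mⱼ` is
the multiplicity of `χⱼ` in `ψ·χ₁`. -/
theorem saxl_stmt1 (G : Type) [Group G] [Fintype G] (x y : G) (χ₁ χ₂ : G → ℂ)
    (h1 : IsIrrChar G χ₁) (h2 : IsIrrChar G χ₂)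
    (hdet : χ₁ x - χ₁ y = χ₂ y - χ₂ x) (hne : χ₁ x ≠ χ₁ y) (hne₂ : χ₂ x ≠ χ₂ y)
    (hothers : ∀ χ : G → ℂ, IsIrrChar G χ → χ ≠ χ₁ → χ ≠ χ₂ → χ x = χ y)
    (ψ : G → ℂ) (hψ : IsChar G ψ) (hxy : ψ x = ψ y)
    (m₁ m₂ : ℕ)
    (hm₁ : charInner G (fun g => ψ g * χ₁ g) χ₁ = m₁)
    (hm₂ : charInner G (fun g => ψ g * χ₁ g) χ₂ = m₂) :
    ψ x = (m₁ : ℂ) - (m₂ : ℂ) := by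
  have h12 : χ₁ ≠ χ₂ := by
    rintro rfl
    exact hne (by linear_combination hdet / 2)
  have key := character_sub_eq h1 h2 h12 hothers (hψ.mul h1.isChar)
  rw [hm₁, hm₂] at key
  apply mul_right_cancel₀ (sub_ne_zero.2 hne)
  linear_combination key - χ₁ y * hxy + (m₂ : ℂ) * hdet

end
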